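/- (Exact-expectation version of Theorem 2: the GenRL greedy path with a β-accurate value oracle and exact averages.) Let T : S → A → S be a shared transition function and R_i : S → A → ℝ, i ∈ I, reward functions forming a family of deterministic MDPs with shared transitions, let D be a probability mass function on I, let H ≥ 1, and let the policy π* : S → A be α-optimal everywhere. Suppose V̂ : I → ℕ → S → ℝ satisfies V*_i(h,s) ≥ V̂_i(h,s) ≥ V*_i(h,s) − β for all i ∈ I, s ∈ S, h ≤ H. Fix s_0 ∈ S and define inductively, for h = 0, …, H−1: a_h is any action attaining the maximum over a ∈ A of E_{i~D}[R_i(s_h, a) + V̂_i(H−h−1, T(s_h, a))], and s_{h+1} = T(s_h, a_h). Then E_{i~D}[Σ_{h<H} R_i(s_h, a_h)] ≥ E_{i~D}[V*_i(H, s_0)] − 3αH − 3βH; in particular this quantity is at least max_{π' : S → A} E_{i~D}[V_i(π', H, s_0)] − 3αH − 3βH. -/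

import Mathlib

open scoped BigOperators

/-- The `h`-step value of a stationary deterministic policy `π` in the deterministic MDP
with transition function `T` and reward function `R`. -/
noncomputable def detVal {S A : Type*} (T : S → A → S) (R : S → A → ℝ)
    (π : S → A) : ℕ → S → ℝ
  | 0, _ => 0
  | h + 1, s => R s (π s) + detVal T R π h (T s (π s))

/-- The `h`-step optimal value in the deterministic MDP `(T, R)`. -/
noncomputable def detOptVal {S A : Type*} [Fintype A] [Nonempty A]
    (T : S → A → S) (R : S → A → ℝ) : ℕ → S → ℝ
  | 0, _ => 0
  | h + 1, s => ⨆ a : A, (R s a + detOptVal T R h (T s a))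

/-- Expectation of `f : I → ℝ` under the probability mass function `D` on the finite type
`I`: `E_{i~D}[f(i)] = Σ_i D(i)·f(i)`. -/
noncomputable def expectD {I : Type*} [Fintype I] (D : PMF I) (f : I → ℝ) : ℝ :=
  ∑ i : I, (D i).toReal * f i

theorem detVal_le_detOptVal {S A : Type*} [Fintype A] [Nonempty A]
    (T : S → A → S) (R : S → A → ℝ) (π : S → A) (h : ℕ) (s : S) :
    detVal T R π h s ≤ detOptVal T R h s := by
  induction h generalizing s with
  | zero => exact le_rfl
  | succ h ih =>
    exact (add_le_add_right (ih (T s (π s))) (R s (π s))).trans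
      (le_ciSup (f := fun a => R s a + detOptVal T R h (T s a))
        (Set.finite_range _).bddAbove (π s))

theorem expectD_mono {I : Type*} [Fintype I] (D : PMF I) {f g : I → ℝ} (hfg : ∀ i, f i ≤ g i) :
    expectD D f ≤ expectD D g :=
  Finset.sum_le_sum fun i _ => mul_le_mul_of_nonneg_left (hfg i) ENNReal.toReal_nonneg

theorem expectD_add {I : Type*} [Fintype I] (D : PMF I) (f g : I → ℝ) :
    expectD D (fun i => f i + g i) = expectD D f + expectD D g := by
  simp only [expectD, mul_add, Finset.sum_add_distrib]

theorem expectD_const {I : Type*} [Fintype I] (D : PMF I) (c : ℝ) :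
    expectD D (fun _ => c) = c := by
  have h : ∑ i, (D i).toReal = 1 := by
    rw [← ENNReal.toReal_sum fun i _ => D.apply_ne_top i, ← tsum_fintype (L := .unconditional I),
      D.tsum_coe, ENNReal.toReal_one]
  rw [expectD, ← Finset.sum_mul, h, one_mul]

/-- If a policy is `α`-optimal from `s` and the oracle is `β`-accurate, then a greedy action for
the averaged oracle loses at most `α + β` in expected optimal value. -/
theorem expectD_detOptVal_succ_le {S A I : Type*} [Fintype A] [Nonempty A] [Fintype I]
    (T : S → A → S) (R : I → S → A → ℝ) (D : PMF I) (α β : ℝ) (π : S → A) (n : ℕ)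
    (s : S) (a : A) (v : I → S → ℝ)
    (hopt : ∀ i, detOptVal T (R i) (n + 1) s - α ≤ detVal T (R i) π (n + 1) s)
    (hub : ∀ i s', v i s' ≤ detOptVal T (R i) n s')
    (hlb : ∀ i s', detOptVal T (R i) n s' - β ≤ v i s')
    (hgreedy : ∀ a', expectD D (fun i => R i s a' + v i (T s a')) ≤
      expectD D (fun i => R i s a + v i (T s a))) :
    expectD D (fun i => detOptVal T (R i) (n + 1) s) ≤
      expectD D (fun i => R i s a) + expectD D (fun i => detOptVal T (R i) n (T s a)) +
        (α + β) := by
  calc expectD D (fun i => detOptVal T (R i) (n + 1) s)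
      ≤ expectD D (fun i => (R i s (π s) + v i (T s (π s))) + (α + β)) := by
        refine expectD_mono D fun i => ?_
        have h₁ := hopt i
        have h₂ := detVal_le_detOptVal T (R i) π n (T s (π s))
        have h₃ := hlb i (T s (π s))
        rw [detVal] at h₁
        linarith
    _ = expectD D (fun i => R i s (π s) + v i (T s (π s))) + (α + β) := by
        rw [expectD_add, expectD_const]
    _ ≤ expectD D (fun i => R i s a + v i (T s a)) + (α + β) := by
        gcongr
        exact hgreedy (π s)
    _ ≤ expectD D (fun i => R i s a + detOptVal T (R i) n (T s a)) + (α + β) := by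
        gcongr
        exact expectD_mono D fun i => by gcongr; exact hub i _
    _ = _ := by rw [expectD_add]

/-- **Exact-expectation version of Theorem 2**: the GenRL greedy path built with a
`β`-accurate optimal-value oracle `V̂` and exact expectations over `D` has expected
cumulative reward at least `E[V*_i(H, s_0)] − 3αH − 3βH`, and in particular at least
`max_{π'} E[V_i(π', H, s_0)] − 3αH − 3βH` (the maximum over the finitely many
deterministic stationary policies is written as a supremum). -/
theorem genRL_exact_expectation
    {S A I : Type*} [Fintype S] [Nonempty S] [Fintype A] [Nonempty A] [Fintype I]
    (T : S → A → S) (R : I → S → A → ℝ)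
    (D : PMF I)
    (H : ℕ) (hH : 1 ≤ H)
    (α β : ℝ) (hα : 0 ≤ α) (hβ : 0 ≤ β)
    (πstar : S → A)
    (hopt : ∀ i : I, ∀ s : S, ∀ h : ℕ, h ≤ H →
      detVal T (R i) πstar h s ≥ detOptVal T (R i) h s - α)
    (Vhat : I → ℕ → S → ℝ)
    (hVhatub : ∀ i : I, ∀ s : S, ∀ h : ℕ, h ≤ H → Vhat i h s ≤ detOptVal T (R i) h s)
    (hVhatlb : ∀ i : I, ∀ s : S, ∀ h : ℕ, h ≤ H →
      detOptVal T (R i) h s - β ≤ Vhat i h s)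
    (s0 : S) (s : ℕ → S) (a : ℕ → A)
    (hs0 : s 0 = s0)
    (hstep : ∀ h : ℕ, h < H → s (h + 1) = T (s h) (a h))
    (hgreedy : ∀ h : ℕ, h < H → ∀ a' : A,
      expectD D (fun i => R i (s h) a' + Vhat i (H - h - 1) (T (s h) a')) ≤
        expectD D (fun i => R i (s h) (a h) + Vhat i (H - h - 1) (T (s h) (a h)))) :
    expectD D (fun i => ∑ h ∈ Finset.range H, R i (s h) (a h)) ≥
        expectD D (fun i => detOptVal T (R i) H s0) - 3 * α * H - 3 * β * H ∧
      expectD D (fun i => ∑ h ∈ Finset.range H, R i (s h) (a h)) ≥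
        (⨆ π' : S → A, expectD D (fun i => detVal T (R i) π' H s0)) -
          3 * α * H - 3 * β * H := by
  have main : ∀ k ≤ H, expectD D (fun i => detOptVal T (R i) H s0) ≤
      expectD D (fun i => ∑ h ∈ Finset.range k, R i (s h) (a h)) +
        expectD D (fun i => detOptVal T (R i) (H - k) (s k)) + k * (α + β) := by
    intro k
    induction k with
    | zero =>
      intro _
      simp [expectD_const, hs0]
    | succ k ih =>
      intro hk
      have h₁ := ih (by omega)
      have hn : H - k = H - (k + 1) + 1 := by omega
      rw [hn] at h₁
      have h₂ := expectD_detOptVal_succ_le T R D α β πstar (H - (k + 1)) (s k) (a k)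
        (fun i => Vhat i (H - (k + 1))) (fun i => hopt i _ _ (by omega))
        (fun i s' => hVhatub i s' _ (by omega)) (fun i s' => hVhatlb i s' _ (by omega))
        (hgreedy k hk)
      rw [← hstep k hk] at h₂
      simp only [Finset.sum_range_succ, expectD_add]
      push_cast
      linarith
  have hfirst : expectD D (fun i => ∑ h ∈ Finset.range H, R i (s h) (a h)) ≥
      expectD D (fun i => detOptVal T (R i) H s0) - 3 * α * H - 3 * β * H := by
    have h := main H le_rfl
    simp only [Nat.sub_self, detOptVal, expectD_const] at h
    have hαH : 0 ≤ α * H := by positivity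
    have hβH : 0 ≤ β * H := by positivity
    linarith
  have hsup : ⨆ π' : S → A, expectD D (fun i => detVal T (R i) π' H s0) ≤
      expectD D (fun i => detOptVal T (R i) H s0) :=
    ciSup_le fun π' => expectD_mono D fun i => detVal_le_detOptVal T (R i) π' H s0
  exact ⟨hfirst, by linarith⟩
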